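/- arXiv:2209.05575 — 4 statements merged into one kernel-verified Lean document; each statement's English description precedes it below -/
import Mathlib

section
/- Let d ≥ 1 and α > 0, and let μ be the measure on ℝ^d with density ω(x) = ‖x‖^α with respect to Lebesgue measure, i.e. μ(E) = ∫_E ‖x‖^α dm_d(x). Then there exists a constant c > 0, depending only on d and α, such that for every ball B ⊂ ℝ^d and every Borel set E ⊆ B, μ(E)/μ(B) ≤ c·(m_d(E)/m_d(B)); that is, μ ∈ M_ψ(ℝ^d) with the linear function ψ(t) = c·t. -/
open MeasureTheory Metric Set

theorem withDensity_norm_rpow_le {V : Type*} [SeminormedAddCommGroup V] [MeasurableSpace V]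
    (μ : Measure V) {α : ℝ} (hα : 0 ≤ α) {x : V} {r : ℝ} {E : Set V} (hE : E ⊆ ball x r)
    (hEm : MeasurableSet E) :
    μ.withDensity (fun y => ENNReal.ofReal (‖y‖ ^ α)) E ≤
      ENNReal.ofReal ((‖x‖ + r) ^ α) * μ E := by
  rw [withDensity_apply _ hEm, ← setLIntegral_const]
  refine setLIntegral_mono' hEm fun y hy => ?_
  gcongr
  have := mem_ball_iff_norm.1 (hE hy)
  linarith [norm_sub_norm_le y x]

section NormedSpace

variable {V : Type*} [NormedAddCommGroup V] [NormedSpace ℝ V]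

/-- Every ball of radius `r` contains a ball of radius `r / 4` on which the norm is at least
a quarter of its supremum over the larger ball. -/
theorem exists_ball_subset_ball_le_norm [Nontrivial V] (x : V) {r : ℝ} (hr : 0 < r) :
    ∃ z : V, ball z (r / 4) ⊆ ball x r ∧ ∀ y ∈ ball z (r / 4), (‖x‖ + r) / 4 ≤ ‖y‖ := by
  obtain ⟨u, hu, hxu⟩ : ∃ u : V, ‖u‖ = 1 ∧ x = ‖x‖ • u := by
    rcases eq_or_ne x 0 with rfl | hx
    · obtain ⟨u, hu⟩ := exists_norm_eq V zero_le_one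
      exact ⟨u, hu, by simp⟩
    · exact ⟨‖x‖⁻¹ • x, norm_smul_inv_norm (𝕜 := ℝ) hx,
        (smul_inv_smul₀ (norm_ne_zero_iff.2 hx) x).symm⟩
  have hz : ‖x + (r / 2) • u‖ = ‖x‖ + r / 2 := by
    nth_rw 1 [hxu]
    rw [← add_smul, norm_smul, hu, mul_one, Real.norm_of_nonneg (by positivity)]
  refine ⟨x + (r / 2) • u, ball_subset_ball' ?_, fun y hy => ?_⟩
  · rw [dist_eq_norm, add_sub_cancel_left, norm_smul, hu, mul_one,
      Real.norm_of_nonneg (by positivity)]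
    linarith
  · rw [mem_ball', dist_eq_norm] at hy
    have := norm_sub_norm_le (x + (r / 2) • u) y
    linarith [norm_nonneg x]

variable [MeasurableSpace V] [BorelSpace V] [FiniteDimensional ℝ V] (μ : Measure V)
  [μ.IsAddHaarMeasure] {α : ℝ}

theorem le_withDensity_norm_rpow_ball [Nontrivial V] (hα : 0 ≤ α) (x : V) {r : ℝ} (hr : 0 < r) :
    ENNReal.ofReal (((‖x‖ + r) / 4) ^ α * (1 / 4) ^ Module.finrank ℝ V) * μ (ball x r) ≤
      μ.withDensity (fun y => ENNReal.ofReal (‖y‖ ^ α)) (ball x r) := by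
  obtain ⟨z, hzx, hz⟩ := exists_ball_subset_ball_le_norm x hr
  refine le_trans ?_ (measure_mono hzx)
  have hball : μ (ball z (r / 4)) =
      ENNReal.ofReal ((1 / 4) ^ Module.finrank ℝ V) * μ (ball x r) := by
    rw [div_eq_inv_mul, Measure.addHaar_ball_mul_of_pos μ z (by norm_num) r,
      Measure.addHaar_ball_center μ x r, one_div]
  rw [withDensity_apply _ measurableSet_ball, ENNReal.ofReal_mul (by positivity), mul_assoc,
    ← hball, ← setLIntegral_const]
  refine setLIntegral_mono' measurableSet_ball fun y hy => ?_
  gcongr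
  exact hz y hy

end NormedSpace

/-- For `d ≥ 1` and `α > 0`, the measure `μ` on `ℝ^d` with density
`ω(x) = ‖x‖^α` with respect to Lebesgue measure satisfies
`μ(E)/μ(B) ≤ c·(m_d(E)/m_d(B))` for every ball `B` and Borel `E ⊆ B`, for a constant `c > 0`
depending only on `d` and `α`; that is, `μ ∈ M_ψ(ℝ^d)` with `ψ(t) = c·t`. -/
theorem norm_rpow_density_linear_condition (d : ℕ) (hd : 1 ≤ d) (α : ℝ) (hα : 0 < α) :
    ∃ c : ℝ, 0 < c ∧
      ∀ (x : EuclideanSpace ℝ (Fin d)) (r : ℝ), 0 < r →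
        ∀ E ⊆ ball x r, MeasurableSet E →
          ((volume.withDensity fun y : EuclideanSpace ℝ (Fin d) =>
              ENNReal.ofReal (‖y‖ ^ α)) E).toReal /
            ((volume.withDensity fun y : EuclideanSpace ℝ (Fin d) =>
              ENNReal.ofReal (‖y‖ ^ α)) (ball x r)).toReal ≤
          c * ((volume E).toReal / (volume (ball x r)).toReal) := by
  have : Nonempty (Fin d) := ⟨⟨0, hd⟩⟩
  refine ⟨4 ^ α * 4 ^ d, by positivity, fun x r hr E hE hEm => ?_⟩
  have hupper := withDensity_norm_rpow_le volume hα.le hE hEm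
  have hball := withDensity_norm_rpow_le volume hα.le (Subset.refl (ball x r)) measurableSet_ball
  have hlower := le_withDensity_norm_rpow_ball volume hα.le x hr
  have hB : volume (ball x r) ≠ ⊤ := measure_ball_lt_top.ne
  have hEtop : volume E ≠ ⊤ := measure_ne_top_of_subset hE hB
  have hBpos : 0 < (volume (ball x r)).toReal :=
    ENNReal.toReal_pos (measure_ball_pos volume x hr).ne' hB
  have hM : 0 < ‖x‖ + r := by positivity
  replace hupper := ENNReal.toReal_mono (ENNReal.mul_ne_top ENNReal.ofReal_ne_top hEtop) hupper
  replace hlower := ENNReal.toReal_mono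
    (hball.trans_lt (ENNReal.mul_lt_top ENNReal.ofReal_lt_top hB.lt_top)).ne hlower
  rw [ENNReal.toReal_mul, ENNReal.toReal_ofReal (by positivity)] at hupper hlower
  rw [finrank_euclideanSpace_fin] at hlower
  refine (div_le_div₀ (by positivity) hupper (by positivity) hlower).trans_eq ?_
  rw [Real.div_rpow hM.le (by norm_num), one_div, inv_pow]
  field_simp
end

section
/- Let d ≥ 1, ε > 0, r₀ > 1, let ℰ be a finite collection of basic cubes in ℝ^d, and for a basic cube I define ρ(I) := inf{ j ∈ ℕ, j ≥ r₀ : #{J ∈ ℰ : J ⊆ Q_j(I)} ≤ (ε/2)·m_d(Q_j(I)) }. Let 𝓜 be any finite family of pairwise disjoint axis-parallel cubes, each of which is a union of basic cubes, such that every J ∈ 𝓜 has edge length ℓ(J) > 8·r₀ and contains a point x_J with ρ(I(x_J)) ≥ ℓ(J)/4. Then Σ_{J∈𝓜} m_d(J) ≤ C_d·#ℰ/ε, where C_d is a constant depending only on the dimension d. -/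
open MeasureTheory Metric Set
open scoped Classical

/-- The basic cube `∏_i [n_i, n_i+1)` in `ℝ^d`. -/
def basicCube (d : ℕ) (n : Fin d → ℤ) : Set (EuclideanSpace ℝ (Fin d)) :=
  {x | ∀ i, (n i : ℝ) ≤ x i ∧ x i < (n i : ℝ) + 1}

/-- `Q_j(I)`: the cube made of `j` layers of basic cubes around the basic cube indexed by `n`,
i.e. `∏_i [n_i − j, n_i + j + 1)`. -/
def layerCube (d : ℕ) (n : Fin d → ℤ) (j : ℕ) : Set (EuclideanSpace ℝ (Fin d)) :=
  {x | ∀ i, (n i : ℝ) - j ≤ x i ∧ x i < (n i : ℝ) + j + 1}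

/-- The index of the basic cube `I(x)` containing `x`. -/
noncomputable def cubeIdx (d : ℕ) (x : EuclideanSpace ℝ (Fin d)) : Fin d → ℤ := fun i => ⌊x i⌋

/-- The axis-parallel cube `∏_i [a_i, a_i + L)`, a union of basic cubes of edge length `L`. -/
def intCube (d : ℕ) (a : Fin d → ℤ) (L : ℕ) : Set (EuclideanSpace ℝ (Fin d)) :=
  {x | ∀ i, (a i : ℝ) ≤ x i ∧ x i < (a i : ℝ) + L}

/-- The lattice points of the box `∏_i [n_i - k, n_i + k]`. -/
noncomputable def latticeBox {d : ℕ} (n : Fin d → ℤ) (k : ℕ) : Finset (Fin d → ℤ) :=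
  Fintype.piFinset fun i => Finset.Icc (n i - k) (n i + k)

theorem mem_latticeBox {d : ℕ} {n q : Fin d → ℤ} {k : ℕ} :
    q ∈ latticeBox n k ↔ ∀ i, n i - k ≤ q i ∧ q i ≤ n i + k := by
  simp [latticeBox]

theorem card_latticeBox {d : ℕ} (n : Fin d → ℤ) (k : ℕ) :
    (latticeBox n k).card = (2 * k + 1) ^ d := by
  have h : ∀ i, (n i + k + 1 - (n i - k)).toNat = 2 * k + 1 := fun i => by omega
  simp [latticeBox, h]

/-- The indices of the basic cubes that make up `intCube d a L`. -/
noncomputable def latticeCells {d : ℕ} (a : Fin d → ℤ) (L : ℕ) : Finset (Fin d → ℤ) :=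
  Fintype.piFinset fun i => Finset.Ico (a i) (a i + L)

theorem mem_latticeCells {d : ℕ} {a q : Fin d → ℤ} {L : ℕ} :
    q ∈ latticeCells a L ↔ ∀ i, a i ≤ q i ∧ q i < a i + L := by
  simp [latticeCells]

theorem card_latticeCells {d : ℕ} (a : Fin d → ℤ) (L : ℕ) :
    (latticeCells a L).card = L ^ d := by
  simp [latticeCells]

theorem toLp_mem_intCube {d : ℕ} {a q : Fin d → ℤ} {L : ℕ} (hq : q ∈ latticeCells a L) :
    (WithLp.toLp 2 fun i => (q i : ℝ)) ∈ intCube d a L := by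
  intro i
  change (a i : ℝ) ≤ q i ∧ (q i : ℝ) < a i + L
  exact_mod_cast mem_latticeCells.1 hq i

theorem disjoint_latticeCells {d : ℕ} {a b : Fin d → ℤ} {K L : ℕ}
    (h : Disjoint (intCube d a K) (intCube d b L)) :
    Disjoint (latticeCells a K) (latticeCells b L) := by
  refine Finset.disjoint_left.2 fun q hqa hqb => ?_
  exact Set.disjoint_left.1 h (toLp_mem_intCube hqa) (toLp_mem_intCube hqb)

theorem cubeIdx_mem_latticeCells {d : ℕ} {a : Fin d → ℤ} {L : ℕ} {x : EuclideanSpace ℝ (Fin d)}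
    (hx : x ∈ intCube d a L) : cubeIdx d x ∈ latticeCells a L := by
  refine mem_latticeCells.2 fun i => ⟨Int.le_floor.2 (hx i).1, Int.floor_lt.2 ?_⟩
  exact_mod_cast (hx i).2

theorem mem_latticeBox_of_basicCube_subset {d : ℕ} {n q : Fin d → ℤ} {j : ℕ}
    (h : basicCube d q ⊆ layerCube d n j) : q ∈ latticeBox n j := by
  have hq : (WithLp.toLp 2 fun i => (q i : ℝ)) ∈ basicCube d q := fun i => by simp
  refine mem_latticeBox.2 fun i => ?_
  obtain ⟨h₁, h₂⟩ : (n i : ℝ) - j ≤ q i ∧ (q i : ℝ) < n i + j + 1 := h hq i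
  refine ⟨by exact_mod_cast h₁, Int.lt_add_one_iff.1 ?_⟩
  exact_mod_cast h₂

/-- Vitali covering for lattice cubes, each paired with a smaller box centred in it:
the boxes of some subfamily are pairwise disjoint, while the cubes of the subfamily carry
a fixed proportion of the total volume. -/
theorem exists_disjoint_latticeBox_subfamily {d : ℕ} (M : Finset ((Fin d → ℤ) × ℕ))
    (hM : (M : Set ((Fin d → ℤ) × ℕ)).PairwiseDisjoint fun p => latticeCells p.1 p.2)
    (n : (Fin d → ℤ) × ℕ → Fin d → ℤ) (j : (Fin d → ℤ) × ℕ → ℕ)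
    (hn : ∀ p ∈ M, n p ∈ latticeCells p.1 p.2) (hj : ∀ p ∈ M, 4 * j p < p.2) :
    ∃ u ⊆ M, (u : Set ((Fin d → ℤ) × ℕ)).PairwiseDisjoint (fun p => latticeBox (n p) (j p)) ∧
      ∑ p ∈ M, p.2 ^ d ≤ 7 ^ d * ∑ p ∈ u, p.2 ^ d := by
  obtain ⟨u, huM, hdisj, hcov⟩ := Vitali.exists_disjoint_subfamily_covering_enlargement
    (fun p => (latticeBox (n p) (j p) : Set (Fin d → ℤ))) (M : Set ((Fin d → ℤ) × ℕ))
    (fun p => (p.2 : ℝ)) 2 one_lt_two (fun p _ => by positivity) (M.sup fun p => p.2 : ℕ)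
    (fun p hp => by exact_mod_cast Finset.le_sup (f := fun p : (Fin d → ℤ) × ℕ => p.2) hp)
    (fun p _ => ⟨n p, Finset.mem_coe.2 <| mem_latticeBox.2 fun i => by omega⟩)
  lift u to Finset ((Fin d → ℤ) × ℕ) using M.finite_toSet.subset huM
  refine ⟨u, Finset.coe_subset.1 huM, fun p hp q hq hpq => ?_, ?_⟩
  · exact Finset.disjoint_coe.1 (hdisj hp hq hpq)
  have hsub : M.biUnion (fun p => latticeCells p.1 p.2) ⊆
      u.biUnion fun p => latticeBox (n p) (3 * p.2) := by
    intro q hq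
    obtain ⟨a, ha, hqa⟩ := Finset.mem_biUnion.1 hq
    obtain ⟨b, hb, ⟨z, hza, hzb⟩, hab⟩ := hcov a ha
    have hab' : a.2 ≤ 2 * b.2 := by exact_mod_cast hab
    refine Finset.mem_biUnion.2 ⟨b, hb, mem_latticeBox.2 fun i => ?_⟩
    have h₁ := mem_latticeCells.1 hqa i
    have h₂ := mem_latticeCells.1 (hn a ha) i
    have h₃ := mem_latticeBox.1 (Finset.mem_coe.1 hza) i
    have h₄ := mem_latticeBox.1 (Finset.mem_coe.1 hzb) i
    have h₅ := hj a ha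
    have h₆ := hj b (huM hb)
    push_cast
    omega
  calc ∑ p ∈ M, p.2 ^ d = (M.biUnion fun p => latticeCells p.1 p.2).card := by
        simp_rw [Finset.card_biUnion hM, card_latticeCells]
    _ ≤ (u.biUnion fun p => latticeBox (n p) (3 * p.2)).card := Finset.card_le_card hsub
    _ ≤ ∑ p ∈ u, (latticeBox (n p) (3 * p.2)).card := Finset.card_biUnion_le
    _ ≤ ∑ p ∈ u, 7 ^ d * p.2 ^ d := Finset.sum_le_sum fun p hp => by
        have := hj p (huM hp)
        rw [card_latticeBox, ← mul_pow]
        exact Nat.pow_le_pow_left (by omega) d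
    _ = 7 ^ d * ∑ p ∈ u, p.2 ^ d := (Finset.mul_sum ..).symm

/-- Measure bound on a maximal-type family `𝓜` of pairwise disjoint cubes
(unions of basic cubes) of edge lengths `> 8r₀`, each containing a point `x_J` with
`ρ(I(x_J)) ≥ ℓ(J)/4`, where `ρ(I)` is the least `j ≥ r₀` with
`#{J ∈ ℰ : J ⊆ Q_j(I)} ≤ (ε/2)·m_d(Q_j(I))`: then `Σ_{J∈𝓜} m_d(J) ≤ C_d·#ℰ/ε`.
(Here `ρ(I(x_J)) ≥ ℓ(J)/4` is expressed by: every admissible `j` is `≥ ℓ(J)/4`.) -/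
theorem maximal_family_measure_bound (d : ℕ) (hd : 1 ≤ d) :
    ∃ C : ℝ, 0 < C ∧
      ∀ ε r₀ : ℝ, 0 < ε → 1 < r₀ →
      ∀ (E : Finset (Fin d → ℤ)) (M : Finset ((Fin d → ℤ) × ℕ)),
        ((M : Set ((Fin d → ℤ) × ℕ)).Pairwise fun p q =>
          Disjoint (intCube d p.1 p.2) (intCube d q.1 q.2)) →
        (∀ p ∈ M, 8 * r₀ < (p.2 : ℝ)) →
        (∀ p ∈ M, ∃ x ∈ intCube d p.1 p.2, ∀ j : ℕ, r₀ ≤ (j : ℝ) →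
          ((E.filter fun q => basicCube d q ⊆ layerCube d (cubeIdx d x) j).card : ℝ) ≤
            ε / 2 * (2 * (j : ℝ) + 1) ^ d →
          (p.2 : ℝ) / 4 ≤ (j : ℝ)) →
        (∑ p ∈ M, ((p.2 : ℝ)) ^ d) ≤ C * E.card / ε := by
  refine ⟨2 * 28 ^ d, by positivity, fun ε r₀ hε hr₀ E M hM hlarge hx => ?_⟩
  choose! x hxmem hx using hx
  let n : (Fin d → ℤ) × ℕ → Fin d → ℤ := fun p => cubeIdx d (x p)
  let j : (Fin d → ℤ) × ℕ → ℕ := fun p => (p.2 - 1) / 4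
  have hj : ∀ p ∈ M, 4 * j p < p.2 ∧ p.2 ≤ 4 * j p + 4 := fun p hp => by
    have h : 0 < p.2 := by
      have := hlarge p hp
      exact_mod_cast (show (0 : ℝ) < p.2 by linarith)
    simp only [j]
    omega
  obtain ⟨u, huM, hu, hsum⟩ := exists_disjoint_latticeBox_subfamily M
    (fun p hp q hq hpq => disjoint_latticeCells (hM hp hq hpq)) n j
    (fun p hp => cubeIdx_mem_latticeCells (hxmem p hp)) fun p hp => (hj p hp).1
  have hcount : ∀ p ∈ M,
      ((p.2 : ℝ)) ^ d ≤ 2 * 4 ^ d / ε * (E ∩ latticeBox (n p) (j p)).card := by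
    intro p hp
    have h₁ : 4 * (j p : ℝ) < p.2 := by exact_mod_cast (hj p hp).1
    have h₂ : (p.2 : ℝ) ≤ 4 * j p + 4 := by exact_mod_cast (hj p hp).2
    have h₃ := hlarge p hp
    have hdense : ε / 2 * (2 * (j p : ℝ) + 1) ^ d <
        (E.filter fun q => basicCube d q ⊆ layerCube d (cubeIdx d (x p)) (j p)).card := by
      by_contra! h
      linarith [hx p hp (j p) (by linarith) h]
    have hle : (E.filter fun q => basicCube d q ⊆ layerCube d (cubeIdx d (x p)) (j p)).card ≤
        (E ∩ latticeBox (n p) (j p)).card := by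
      refine Finset.card_le_card fun q hq => ?_
      rw [Finset.mem_filter] at hq
      exact Finset.mem_inter.2 ⟨hq.1, mem_latticeBox_of_basicCube_subset hq.2⟩
    have hpow : (p.2 : ℝ) ^ d ≤ 4 ^ d * (2 * (j p : ℝ) + 1) ^ d := by
      rw [← mul_pow]
      exact pow_le_pow_left₀ (by positivity) (by linarith) d
    calc (p.2 : ℝ) ^ d ≤ 4 ^ d * (2 * (j p : ℝ) + 1) ^ d := hpow
      _ = 2 * 4 ^ d / ε * (ε / 2 * (2 * (j p : ℝ) + 1) ^ d) := by field_simp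
      _ ≤ 2 * 4 ^ d / ε * (E ∩ latticeBox (n p) (j p)).card := by
        gcongr
        exact hdense.le.trans (by exact_mod_cast hle)
  have htotal : ∑ p ∈ u, (E ∩ latticeBox (n p) (j p)).card ≤ E.card := by
    rw [← Finset.card_biUnion fun p hp q hq hpq =>
      (hu hp hq hpq).mono Finset.inter_subset_right Finset.inter_subset_right]
    exact Finset.card_le_card (Finset.biUnion_subset.2 fun p _ => Finset.inter_subset_left)
  calc ∑ p ∈ M, (p.2 : ℝ) ^ d ≤ 7 ^ d * ∑ p ∈ u, (p.2 : ℝ) ^ d := by exact_mod_cast hsum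
    _ ≤ 7 ^ d * ∑ p ∈ u, 2 * 4 ^ d / ε * ((E ∩ latticeBox (n p) (j p)).card : ℝ) := by
      gcongr with p hp
      exact hcount p (huM hp)
    _ = 7 ^ d * (2 * 4 ^ d / ε) * ((∑ p ∈ u, (E ∩ latticeBox (n p) (j p)).card : ℕ) : ℝ) := by
      rw [← Finset.mul_sum, Nat.cast_sum, mul_assoc]
    _ ≤ 7 ^ d * (2 * 4 ^ d / ε) * E.card := by gcongr
    _ = 2 * 28 ^ d * E.card / ε := by
      rw [show (28 : ℝ) = 7 * 4 by norm_num, mul_pow]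
      ring
end

section
/- Let d ≥ 1. There exists a constant C_d, depending only on d, such that for every integer k ≥ 1 and every axis-parallel cube J ⊂ ℝ^d which is a union of basic cubes and has edge length ℓ(J), the number of basic cubes I such that the cubical annulus A(I,k) := Q_k(I) ∖ Q_{k−1}(I) intersects J satisfies #{I basic cube : A(I,k) ∩ J ≠ ∅} ≤ C_d·(ℓ(J)^d + k^{d−1}·ℓ(J)). -/
open MeasureTheory Metric Set

/-- The cubical annulus `A(I,k) = Q_k(I) ∖ Q_{k−1}(I)`, the `k`-th layer of basic cubes
surrounding the basic cube indexed by `n`. -/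
def annulus (d : ℕ) (n : Fin d → ℤ) (k : ℕ) : Set (EuclideanSpace ℝ (Fin d)) :=
  layerCube d n k \ layerCube d n (k - 1)

/-- Index vectors whose `i`-th coordinate lies in `[c, c + L)` and whose other coordinates lie in
`[a_j - k, a_j + L + k)`. -/
noncomputable def indexSlab (d k : ℕ) (a : Fin d → ℤ) (L : ℕ) (i : Fin d) (c : ℤ) : Finset (Fin d → ℤ) :=
  Fintype.piFinset fun j =>
    if j = i then Finset.Ico c (c + L) else Finset.Ico (a j - k) (a j + L + k)

theorem card_indexSlab (d k : ℕ) (a : Fin d → ℤ) (L : ℕ) (i : Fin d) (c : ℤ) :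
    (indexSlab d k a L i c).card = L * (L + 2 * k) ^ (d - 1) := by
  have h : ∀ j ∈ Finset.univ.erase i,
      (if j = i then Finset.Ico c (c + L) else Finset.Ico (a j - k) (a j + L + k)).card
        = L + 2 * k := by
    intro j hj
    rw [if_neg (Finset.ne_of_mem_erase hj), Int.card_Ico]
    lia
  rw [indexSlab, Fintype.card_piFinset, ← Finset.mul_prod_erase _ _ (Finset.mem_univ i),
    Finset.prod_congr rfl h]
  simp

theorem mem_indexSlab_of_annulus_inter_intCube {d k : ℕ} (hk : 1 ≤ k) {a : Fin d → ℤ} {L : ℕ}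
    {n : Fin d → ℤ} (h : (annulus d n k ∩ intCube d a L).Nonempty) :
    ∃ i, n ∈ indexSlab d k a L i (a i + k) ∪ indexSlab d k a L i (a i - k) := by
  obtain ⟨x, ⟨hx, hx'⟩, hJ⟩ := h
  have hn : ∀ j, n j ∈ Finset.Ico (a j - k) (a j + L + k) := by
    intro j
    have h1 : (a j : ℝ) < n j + k + 1 := (hJ j).1.trans_lt (hx j).2
    have h2 : (n j : ℝ) - k < a j + L := (hx j).1.trans_lt (hJ j).2
    have h3 : a j < n j + k + 1 := by exact_mod_cast h1
    have h4 : n j - k < a j + L := by exact_mod_cast h2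
    rw [Finset.mem_Ico]
    lia
  simp only [layerCube, mem_ofPred_eq, not_forall] at hx'
  obtain ⟨i, hi⟩ := hx'
  have key : n i ∈ Finset.Ico (a i + k) (a i + k + L) ∨
      n i ∈ Finset.Ico (a i - k) (a i - k + L) := by
    have hni := Finset.mem_Ico.1 (hn i)
    simp only [Finset.mem_Ico]
    rw [Nat.cast_sub hk, Nat.cast_one] at hi
    by_cases hlow : (n i : ℝ) - (k - 1) ≤ x i
    · right
      have h1 : (n i : ℝ) + k < a i + L := by
        have := (hJ i).2
        have : (n i : ℝ) + (k - 1) + 1 ≤ x i := not_lt.1 fun h => hi ⟨hlow, h⟩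
        linarith
      have h2 : n i + k < a i + L := by exact_mod_cast h1
      lia
    · left
      have h1 : (a i : ℝ) + k < n i + 1 := by
        have := (hJ i).1
        linarith
      have h2 : a i + k < n i + 1 := by exact_mod_cast h1
      lia
  refine ⟨i, Finset.mem_union.2 (key.imp ?_ ?_)⟩ <;>
  · intro h
    refine Fintype.mem_piFinset.2 fun j => ?_
    split_ifs with hj
    · exact hj ▸ h
    · exact hn j

theorem add_two_mul_pow_le {x y : ℝ} (hx : 0 ≤ x) (hy : 0 ≤ y) (m : ℕ) :
    (x + 2 * y) ^ m ≤ 3 ^ m * (x ^ m + y ^ m) := by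
  rcases le_total x y with h | h
  · calc (x + 2 * y) ^ m ≤ (3 * y) ^ m := by gcongr; linarith
      _ = 3 ^ m * y ^ m := mul_pow _ _ _
      _ ≤ 3 ^ m * (x ^ m + y ^ m) := by gcongr; linarith [pow_nonneg hx m]
  · calc (x + 2 * y) ^ m ≤ (3 * x) ^ m := by gcongr; linarith
      _ = 3 ^ m * x ^ m := mul_pow _ _ _
      _ ≤ 3 ^ m * (x ^ m + y ^ m) := by gcongr; linarith [pow_nonneg hy m]

/-- There is a constant `C_d` depending only on `d` such that for every
`k ≥ 1` and every axis-parallel cube `J` which is a union of basic cubes with edge length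
`ℓ(J)`, the number of basic cubes `I` whose annulus `A(I,k)` meets `J` is at most
`C_d·(ℓ(J)^d + k^{d−1}·ℓ(J))`. -/
theorem annulus_intersection_count (d : ℕ) (hd : 1 ≤ d) :
    ∃ C : ℝ, 0 < C ∧
      ∀ k : ℕ, 1 ≤ k → ∀ (a : Fin d → ℤ) (L : ℕ), 1 ≤ L →
        {n : Fin d → ℤ | (annulus d n k ∩ intCube d a L).Nonempty}.Finite ∧
        ({n : Fin d → ℤ | (annulus d n k ∩ intCube d a L).Nonempty}.ncard : ℝ) ≤
          C * ((L : ℝ) ^ d + (k : ℝ) ^ (d - 1) * (L : ℝ)) := by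
  refine ⟨2 * d * 3 ^ (d - 1), by positivity, fun k hk a L _ => ?_⟩
  let T : Finset (Fin d → ℤ) := Finset.univ.biUnion fun i =>
    indexSlab d k a L i (a i + k) ∪ indexSlab d k a L i (a i - k)
  have hsub : {n : Fin d → ℤ | (annulus d n k ∩ intCube d a L).Nonempty} ⊆ T := by
    intro n hn
    obtain ⟨i, hi⟩ := mem_indexSlab_of_annulus_inter_intCube hk hn
    exact Finset.mem_coe.2 (Finset.mem_biUnion.2 ⟨i, Finset.mem_univ i, hi⟩)
  refine ⟨T.finite_toSet.subset hsub, ?_⟩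
  have hT : T.card ≤ d * (2 * (L * (L + 2 * k) ^ (d - 1))) := by
    refine (Finset.card_biUnion_le_card_mul _ _ (2 * (L * (L + 2 * k) ^ (d - 1)))
      fun i _ => ?_).trans_eq (by rw [Finset.card_univ, Fintype.card_fin])
    refine (Finset.card_union_le _ _).trans_eq ?_
    rw [card_indexSlab, card_indexSlab, ← two_mul]
  have hcard : {n : Fin d → ℤ | (annulus d n k ∩ intCube d a L).Nonempty}.ncard
      ≤ d * (2 * (L * (L + 2 * k) ^ (d - 1))) :=
    ((ncard_le_ncard hsub T.finite_toSet).trans_eq (ncard_coe_finset T)).trans hT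
  calc ({n : Fin d → ℤ | (annulus d n k ∩ intCube d a L).Nonempty}.ncard : ℝ)
      ≤ d * (2 * (L * ((L : ℝ) + 2 * k) ^ (d - 1))) := by exact_mod_cast hcard
    _ ≤ d * (2 * (L * (3 ^ (d - 1) * ((L : ℝ) ^ (d - 1) + (k : ℝ) ^ (d - 1))))) := by
        gcongr
        exact add_two_mul_pow_le (Nat.cast_nonneg L) (Nat.cast_nonneg k) _
    _ = 2 * d * 3 ^ (d - 1) * ((L : ℝ) ^ d + (k : ℝ) ^ (d - 1) * L) := by
        rw [← pow_sub_one_mul (Nat.one_le_iff_ne_zero.1 hd) (L : ℝ)]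
        ring
end

section
/- Let d ≥ 2, let N be a (large) power of 2, let α > 0, let m₀ ∈ ℕ, and let (n_ℓ)_{ℓ≥m₀} be nonnegative integers, only finitely many nonzero, with Σ_{ℓ≥m₀} 2^{d·ℓ}·n_ℓ ≤ S for some S > 0. For m ≥ m₀ define s_m := min{ (α·N^d / Σ_{ℓ≥m} 2^ℓ·n_ℓ)^{1/(d−1)} + 2^{m+2}, N/(10²·d) } (with the convention s_m = N/(10²·d) when Σ_{ℓ≥m} 2^ℓ n_ℓ = 0), let m̄+1 be the first index with s_{m̄+1} = N/(10²·d), and define the step function M(k) := 2^{m₀} for k ≤ s_{m₀} and M(k) := 2^m for s_{m−1} < k ≤ s_m, m₀ < m ≤ m̄+1. Then Σ_{k=1}^{⌊N/(10²·d)⌋} 1/M(k) ≥ c · N/(1+(S/N)^{1/(d−1)}) · (log(2+S/N))^{d/(d−1)}, where c > 0 is a constant depending only on d, α and m₀. -/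
open Finset

/-- On `{k ≤ s p}`, a step function with values `2 ^ m` on the `m`-th step takes the value `2 ^ m`
for the least `m ≥ m₀` with `k ≤ s m`. -/
lemma exists_least_scale_of_step {m₀ p : ℕ} (hp : m₀ ≤ p) {s M : ℕ → ℝ}
    (hM₀ : ∀ k : ℕ, (k : ℝ) ≤ s m₀ → M k = 2 ^ m₀)
    (hM : ∀ k : ℕ, ∀ m : ℕ, m₀ < m → m ≤ p → s (m - 1) < (k : ℝ) → (k : ℝ) ≤ s m → M k = 2 ^ m)
    {k : ℕ} (hk : (k : ℝ) ≤ s p) :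
    ∃ m, m ≤ p ∧ M k = 2 ^ m ∧ ∀ j, m₀ ≤ j → (k : ℝ) ≤ s j → m ≤ j := by
  classical
  have hex : ∃ m, m₀ ≤ m ∧ (k : ℝ) ≤ s m := ⟨p, hp, hk⟩
  obtain ⟨h₁, h₂⟩ := Nat.find_spec hex
  have hle : Nat.find hex ≤ p := Nat.find_min' hex ⟨hp, hk⟩
  refine ⟨Nat.find hex, hle, ?_, fun j hj hkj => Nat.find_min' hex ⟨hj, hkj⟩⟩
  rcases h₁.eq_or_lt with h | h
  · rw [← h] at h₂ ⊢
    exact hM₀ k h₂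
  · refine hM k _ h hle ?_ h₂
    by_contra! hcon
    have := Nat.find_min' hex ⟨Nat.le_sub_one_of_lt h, hcon⟩
    omega

lemma sum_Ico_half_pow_succ_le (m p : ℕ) :
    ∑ j ∈ Ico m p, (1 / 2 : ℝ) ^ (j + 1) ≤ (1 / 2) ^ m := by
  rcases le_total p m with h | h
  · rw [Ico_eq_empty_of_le h]
    simp
  · suffices ∑ j ∈ Ico m p, (1 / 2 : ℝ) ^ (j + 1) = (1 / 2) ^ m - (1 / 2) ^ p by
      rw [this]
      linarith [pow_pos (by norm_num : (0 : ℝ) < 1 / 2) p]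
    induction p, h using Nat.le_induction with
    | base => simp
    | succ p hp ih =>
      rw [sum_Ico_succ_top hp, ih]
      ring

/-- Layer-cake lower bound for the sum of the reciprocals of a dyadic step function. -/
lemma sum_half_pow_mul_le_sum_inv_step {m₀ p : ℕ} (hp : m₀ ≤ p) {s M : ℕ → ℝ}
    (hM₀ : ∀ k : ℕ, (k : ℝ) ≤ s m₀ → M k = 2 ^ m₀)
    (hM : ∀ k : ℕ, ∀ m : ℕ, m₀ < m → m ≤ p → s (m - 1) < (k : ℝ) → (k : ℝ) ≤ s m → M k = 2 ^ m)
    (hs : ∀ m ∈ Ico m₀ p, 1 ≤ s m ∧ s m ≤ s p) :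
    ∑ m ∈ Ico m₀ p, (1 / 2 : ℝ) ^ (m + 2) * s m ≤ ∑ k ∈ Icc 1 ⌊s p⌋₊, 1 / M k := by
  classical
  calc ∑ m ∈ Ico m₀ p, (1 / 2 : ℝ) ^ (m + 2) * s m
      ≤ ∑ m ∈ Ico m₀ p, ∑ k ∈ Icc 1 ⌊s p⌋₊, if (k : ℝ) ≤ s m then (1 / 2 : ℝ) ^ (m + 1) else 0 := by
        refine sum_le_sum fun m hm => ?_
        obtain ⟨h1, h2⟩ := hs m hm
        have hsub : Icc 1 ⌊s m⌋₊ ⊆ (Icc 1 ⌊s p⌋₊).filter fun k : ℕ => (k : ℝ) ≤ s m := by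
          intro k hk
          rw [mem_Icc] at hk
          rw [mem_filter, mem_Icc]
          exact ⟨⟨hk.1, hk.2.trans (Nat.floor_mono h2)⟩,
            (Nat.le_floor_iff (by linarith)).1 hk.2⟩
        have hcard := card_le_card hsub
        rw [Nat.card_Icc, Nat.add_sub_cancel] at hcard
        have hfl : s m / 2 ≤ (⌊s m⌋₊ : ℝ) := by
          have h3 := Nat.lt_floor_add_one (s m)
          have h4 : (1 : ℝ) ≤ (⌊s m⌋₊ : ℝ) := by
            exact_mod_cast (Nat.one_le_floor_iff (s m)).2 h1
          linarith
        rw [← sum_filter, sum_const, nsmul_eq_mul]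
        have hcard' : (⌊s m⌋₊ : ℝ) ≤ _ := Nat.cast_le.2 hcard
        have hpos : (0 : ℝ) < (1 / 2) ^ (m + 1) := by positivity
        calc (1 / 2 : ℝ) ^ (m + 2) * s m = s m / 2 * (1 / 2) ^ (m + 1) := by ring
          _ ≤ _ := mul_le_mul_of_nonneg_right (hfl.trans hcard') hpos.le
    _ = ∑ k ∈ Icc 1 ⌊s p⌋₊, ∑ m ∈ Ico m₀ p, if (k : ℝ) ≤ s m then (1 / 2 : ℝ) ^ (m + 1) else 0 :=
        sum_comm
    _ ≤ ∑ k ∈ Icc 1 ⌊s p⌋₊, 1 / M k := by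
        refine sum_le_sum fun k hk => ?_
        rw [mem_Icc] at hk
        obtain ⟨m, -, hMk, hmin⟩ :=
          exists_least_scale_of_step hp hM₀ hM ((Nat.le_floor_iff' (by omega)).1 hk.2)
        rw [hMk, ← sum_filter, ← one_div_pow]
        refine le_trans (sum_le_sum_of_subset_of_nonneg ?_ fun _ _ _ => by positivity)
          (sum_Ico_half_pow_succ_le m p)
        intro j hj
        rw [mem_filter, mem_Ico] at hj
        exact mem_Ico.2 ⟨hmin j hj.1.1 hj.2, hj.1.2⟩

lemma div_two_pow_le_sum_inv_step {m₀ p : ℕ} (hp : m₀ ≤ p) {s M : ℕ → ℝ}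
    (hM₀ : ∀ k : ℕ, (k : ℝ) ≤ s m₀ → M k = 2 ^ m₀)
    (hM : ∀ k : ℕ, ∀ m : ℕ, m₀ < m → m ≤ p → s (m - 1) < (k : ℝ) → (k : ℝ) ≤ s m → M k = 2 ^ m)
    (hs : 1 ≤ s p) :
    s p / 2 ^ (p + 1) ≤ ∑ k ∈ Icc 1 ⌊s p⌋₊, 1 / M k := by
  have hfl : s p / 2 ≤ (⌊s p⌋₊ : ℝ) := by
    have h3 := Nat.lt_floor_add_one (s p)
    have h4 : (1 : ℝ) ≤ (⌊s p⌋₊ : ℝ) := by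
      exact_mod_cast (Nat.one_le_floor_iff (s p)).2 hs
    linarith
  calc s p / 2 ^ (p + 1) = s p / 2 * (1 / 2 ^ p) := by rw [pow_succ]; field_simp
    _ ≤ (⌊s p⌋₊ : ℝ) * (1 / 2 ^ p) := by gcongr
    _ = ∑ k ∈ Icc 1 ⌊s p⌋₊, (1 / 2 ^ p : ℝ) := by simp
    _ ≤ _ := by
      refine sum_le_sum fun k hk => ?_
      rw [mem_Icc] at hk
      obtain ⟨m, hmp, hMk, -⟩ :=
        exists_least_scale_of_step hp hM₀ hM ((Nat.le_floor_iff' (by omega)).1 hk.2)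
      rw [hMk]
      gcongr
      norm_num

lemma sum_range_succ_two_pow_mul_le {e : ℕ} (he : 1 ≤ e) (ℓ : ℕ) :
    ∑ m ∈ range (ℓ + 1), (2 : ℝ) ^ (e * m) ≤ 2 * 2 ^ (e * ℓ) := by
  induction ℓ with
  | zero => simp
  | succ ℓ ih =>
    rw [sum_range_succ, mul_add_one, pow_add]
    have h2 : (2 : ℝ) ≤ 2 ^ e := by
      simpa using pow_le_pow_right₀ (by norm_num : (1 : ℝ) ≤ 2) he
    nlinarith [pow_pos (by norm_num : (0 : ℝ) < 2) (e * ℓ)]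

/-- The weighted tails `2^{em} Σ_{ℓ≥m} 2^ℓ n_ℓ` sum to at most twice `Σ_ℓ 2^{(e+1)ℓ} n_ℓ`. -/
lemma sum_two_pow_mul_tail_le {e : ℕ} (he : 1 ≤ e) (a b L : ℕ) (n : ℕ → ℕ) :
    ∑ m ∈ Ico a b, (2 : ℝ) ^ (e * m) * ∑ ℓ ∈ Ico m L, (2 : ℝ) ^ ℓ * (n ℓ : ℝ) ≤
      2 * ∑ ℓ ∈ range L, (2 : ℝ) ^ ((e + 1) * ℓ) * (n ℓ : ℝ) := by
  classical
  calc ∑ m ∈ Ico a b, (2 : ℝ) ^ (e * m) * ∑ ℓ ∈ Ico m L, (2 : ℝ) ^ ℓ * (n ℓ : ℝ)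
      = ∑ m ∈ Ico a b, ∑ ℓ ∈ range L,
          if m ≤ ℓ then (2 : ℝ) ^ (e * m) * ((2 : ℝ) ^ ℓ * (n ℓ : ℝ)) else 0 := by
        refine sum_congr rfl fun m _ => ?_
        rw [mul_sum, ← sum_filter]
        refine sum_congr ?_ fun _ _ => rfl
        ext ℓ
        simp [and_comm]
    _ = ∑ ℓ ∈ range L, ∑ m ∈ Ico a b,
          if m ≤ ℓ then (2 : ℝ) ^ (e * m) * ((2 : ℝ) ^ ℓ * (n ℓ : ℝ)) else 0 := sum_comm
    _ ≤ ∑ ℓ ∈ range L, 2 * ((2 : ℝ) ^ ((e + 1) * ℓ) * (n ℓ : ℝ)) := by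
        refine sum_le_sum fun ℓ _ => ?_
        rw [← sum_filter, ← sum_mul]
        have hsub : (Ico a b).filter (fun m => m ≤ ℓ) ⊆ range (ℓ + 1) := by
          intro m hm
          rw [mem_filter] at hm
          exact mem_range.2 (by omega)
        calc _ ≤ (2 * (2 : ℝ) ^ (e * ℓ)) * ((2 : ℝ) ^ ℓ * (n ℓ : ℝ)) := by
              refine mul_le_mul_of_nonneg_right ?_ (by positivity)
              exact (sum_le_sum_of_subset_of_nonneg hsub fun _ _ _ => by positivity).trans
                (sum_range_succ_two_pow_mul_le he ℓ)
          _ = _ := by ring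
    _ = _ := by rw [mul_sum]

/-- Jensen's inequality for `x ↦ x ^ (-q)`. -/
lemma card_mul_rpow_le_sum_rpow_inv {ι : Type*} {t : Finset ι} {a : ι → ℝ} {q B : ℝ} (hq : 0 ≤ q)
    (hB : 0 < B) (ha : ∀ i ∈ t, 0 < a i) (hsum : ∑ i ∈ t, a i ≤ B) :
    (#t : ℝ) * (#t / B) ^ q ≤ ∑ i ∈ t, (1 / a i) ^ q := by
  rcases t.eq_empty_or_nonempty with rfl | ht
  · simp
  have hJ : (0 : ℝ) < #t := by exact_mod_cast ht.card_pos
  set J : ℝ := (#t : ℝ)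
  have key : ∀ i ∈ t, (J / B) ^ q * (1 - q * (J / B * a i - 1)) ≤ (1 / a i) ^ q := by
    intro i hi
    have hai := ha i hi
    have hx : 0 < J / B * a i := by positivity
    have heq : (1 / a i) ^ q = (J / B) ^ q * (J / B * a i) ^ (-q) := by
      rw [Real.rpow_neg hx.le, ← Real.inv_rpow hx.le, ← Real.mul_rpow (by positivity) (by positivity)]
      congr 1
      field_simp
    rw [heq]
    refine mul_le_mul_of_nonneg_left ?_ (by positivity)
    rw [Real.rpow_def_of_pos hx]
    have h1 := Real.add_one_le_exp (Real.log (J / B * a i) * -q)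
    have h2 := mul_le_mul_of_nonneg_left (Real.log_le_sub_one_of_pos hx) hq
    linarith
  refine le_trans ?_ (sum_le_sum key)
  rw [← mul_sum, mul_comm]
  refine mul_le_mul_of_nonneg_left ?_ (by positivity)
  rw [sum_sub_distrib, ← mul_sum, sum_sub_distrib, ← mul_sum]
  simp only [sum_const, nsmul_eq_mul, mul_one]
  have h3 : J / B * ∑ i ∈ t, a i ≤ J := by
    calc J / B * ∑ i ∈ t, a i ≤ J / B * B := by gcongr
      _ = J := by field_simp
  nlinarith

/-- Trading an exponential bound against a polynomial one in the number `J` of scales. -/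
lemma min_mul_log_rpow_le_max {q a b A : ℝ} (hq : 0 < q) (hq1 : q ≤ 1) (ha : 0 < a) (hb : 0 < b)
    (hA : 0 < A) (J : ℕ) :
    min (a * (q / (2 * (1 + q))) ^ (1 + q) / 2) (b * (q / 2) ^ (1 + q)) *
        (1 / (1 + A ^ q) * Real.log (2 + A) ^ (1 + q)) ≤
      max (a / 2 ^ J) (b * (1 / A) ^ q * (J : ℝ) ^ (1 + q)) := by
  have hAq : 0 < A ^ q := Real.rpow_pos_of_pos hA q
  have hlog : 0 < Real.log (2 + A) := Real.log_pos (by linarith)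
  have hfac : 0 ≤ 1 / (1 + A ^ q) * Real.log (2 + A) ^ (1 + q) := by positivity
  set y := (2 + A) ^ (q / 2) with hy
  have hy0 : 0 < y := by positivity
  have hyy : y * y ≤ 2 * (1 + A ^ q) := by
    rw [hy, ← Real.rpow_add (by linarith), add_halves]
    have h1 := Real.rpow_add_le_add_rpow (by norm_num : (0 : ℝ) ≤ 2) hA.le hq.le hq1
    have h2 : (2 : ℝ) ^ q ≤ 2 ^ (1 : ℝ) := Real.rpow_le_rpow_of_exponent_le (by norm_num) hq1
    rw [Real.rpow_one] at h2
    linarith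
  rcases le_or_gt ((2 : ℝ) ^ J) y with hJ | hJ
  · refine le_max_of_le_left ((mul_le_mul_of_nonneg_right (min_le_left _ _) hfac).trans ?_)
    set ε := q / (2 * (1 + q)) with hε
    have hε0 : 0 < ε := by positivity
    have h1 : (ε * Real.log (2 + A)) ^ (1 + q) ≤ y := by
      have h2 := Real.log_le_rpow_div (by linarith : 0 ≤ 2 + A) hε0
      rw [le_div_iff₀ hε0, mul_comm] at h2
      calc _ ≤ ((2 + A) ^ ε) ^ (1 + q) := Real.rpow_le_rpow (by positivity) h2 (by linarith)
        _ = y := by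
          rw [← Real.rpow_mul (by linarith), hy, hε]
          congr 1
          field_simp
    rw [Real.mul_rpow hε0.le hlog.le] at h1
    calc a * ε ^ (1 + q) / 2 * (1 / (1 + A ^ q) * Real.log (2 + A) ^ (1 + q))
        = a * (ε ^ (1 + q) * Real.log (2 + A) ^ (1 + q)) / (2 * (1 + A ^ q)) := by field_simp
      _ ≤ a * y / (y * y) := by gcongr
      _ = a / y := by field_simp
      _ ≤ a / 2 ^ J := by gcongr
  · refine le_max_of_le_right ((mul_le_mul_of_nonneg_right (min_le_right _ _) hfac).trans ?_)
    have h1 : q / 2 * Real.log (2 + A) ≤ J := by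
      have h2 := Real.log_le_log hy0 hJ.le
      rw [hy, Real.log_rpow (by linarith), Real.log_pow] at h2
      have h3 : Real.log 2 ≤ 1 := by linarith [Real.log_two_lt_d9]
      nlinarith [(Nat.cast_nonneg J : (0 : ℝ) ≤ J)]
    have h4 := Real.rpow_le_rpow (by positivity) h1 (by linarith : 0 ≤ 1 + q)
    rw [Real.mul_rpow (by positivity) hlog.le] at h4
    have h5 : 1 / (1 + A ^ q) ≤ (1 / A) ^ q := by
      rw [Real.div_rpow zero_le_one hA.le, Real.one_rpow]
      gcongr
      linarith
    calc b * (q / 2) ^ (1 + q) * (1 / (1 + A ^ q) * Real.log (2 + A) ^ (1 + q))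
        = b * (1 / (1 + A ^ q)) * ((q / 2) ^ (1 + q) * Real.log (2 + A) ^ (1 + q)) := by ring
      _ ≤ b * (1 / A) ^ q * (J : ℝ) ^ (1 + q) := by gcongr

/-- The final estimate in the stopping-time construction: for the step
function `M` built from the sequence `s_m = min((α N^d / Σ_{ℓ≥m} 2^ℓ n_ℓ)^{1/(d−1)} + 2^{m+2},
N/(100d))` (with `s_m = N/(100d)` when the tail sum vanishes), where the dyadic-scale counts
`n_ℓ` satisfy `Σ_ℓ 2^{dℓ} n_ℓ ≤ S` and vanish for `ℓ < m₀` and `ℓ ≥ L`, and `m̄+1` is the first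
index with `s_{m̄+1} = N/(100d)`, one has
`Σ_{k=1}^{⌊N/(100d)⌋} 1/M(k) ≥ c·N/(1+(S/N)^{1/(d−1)})·(log(2+S/N))^{d/(d−1)}`
for a constant `c > 0` depending only on `d`, `α`, `m₀`, provided `N` is a large power of 2. -/
theorem step_function_sum_lower_bound (d : ℕ) (hd : 2 ≤ d) (α : ℝ) (hα : 0 < α) (m₀ : ℕ) :
    ∃ c : ℝ, 0 < c ∧ ∃ N₀ : ℕ, ∀ N : ℕ, N₀ ≤ N → (∃ K : ℕ, N = 2 ^ K) →
      ∀ S : ℝ, 0 < S →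
      ∀ (n : ℕ → ℕ) (L : ℕ),
        (∀ ℓ, ℓ < m₀ → n ℓ = 0) → (∀ ℓ, L ≤ ℓ → n ℓ = 0) →
        (∑ ℓ ∈ Finset.range L, (2 : ℝ) ^ (d * ℓ) * (n ℓ : ℝ)) ≤ S →
      ∀ s : ℕ → ℝ,
        (∀ m, s m =
          if (∑ ℓ ∈ Finset.Ico m L, 2 ^ ℓ * n ℓ) = 0 then (N : ℝ) / (100 * d)
          else min
            ((α * (N : ℝ) ^ d / (∑ ℓ ∈ Finset.Ico m L, (2 : ℝ) ^ ℓ * (n ℓ : ℝ))) ^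
                ((1 : ℝ) / ((d : ℝ) - 1)) + 2 ^ (m + 2))
            ((N : ℝ) / (100 * d))) →
      ∀ mbar : ℕ, m₀ ≤ mbar + 1 →
        s (mbar + 1) = (N : ℝ) / (100 * d) →
        (∀ m, m₀ ≤ m → m ≤ mbar → s m < (N : ℝ) / (100 * d)) →
      ∀ M : ℕ → ℝ,
        (∀ k : ℕ, (k : ℝ) ≤ s m₀ → M k = 2 ^ m₀) →
        (∀ k : ℕ, ∀ m : ℕ, m₀ < m → m ≤ mbar + 1 →
          s (m - 1) < (k : ℝ) → (k : ℝ) ≤ s m → M k = 2 ^ m) →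
      c * ((N : ℝ) / (1 + (S / N) ^ ((1 : ℝ) / ((d : ℝ) - 1))) *
          Real.log (2 + S / N) ^ ((d : ℝ) / ((d : ℝ) - 1))) ≤
        ∑ k ∈ Finset.Icc 1 ⌊(N : ℝ) / (100 * d)⌋₊, 1 / M k := by
  have hd1 : (1 : ℝ) ≤ (d : ℝ) - 1 := by
    have : (2 : ℝ) ≤ d := by exact_mod_cast hd
    linarith
  have hd0 : (0 : ℝ) < d := by linarith
  obtain ⟨e, rfl⟩ : ∃ e, d = e + 1 := ⟨d - 1, by omega⟩
  have he : 1 ≤ e := by omega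
  have he0 : (0 : ℝ) < e := by exact_mod_cast he
  have hee : ((e + 1 : ℕ) : ℝ) - 1 = e := by push_cast; ring
  set q : ℝ := 1 / (e : ℝ) with hqdef
  have hq : 0 < q := by positivity
  have hq1 : q ≤ 1 := by
    rw [hee] at hd1
    exact (div_le_one he0).2 hd1
  have hdq : ((e + 1 : ℕ) : ℝ) / e = 1 + q := by
    rw [hqdef]
    push_cast
    field_simp
  have heq : (e : ℝ) * q = 1 := by rw [hqdef]; field_simp
  rw [hee, hdq]
  simp only [← hqdef]
  set D : ℝ := 100 * ((e + 1 : ℕ) : ℝ) with hD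
  have hD0 : 0 < D := by positivity
  set a : ℝ := 1 / (D * 2 ^ (m₀ + 1)) with ha
  set b : ℝ := 1 / 4 * (α / 2) ^ q with hb
  have ha0 : 0 < a := by positivity
  have hb0 : 0 < b := by positivity
  refine ⟨min (a * (q / (2 * (1 + q))) ^ (1 + q) / 2) (b * (q / 2) ^ (1 + q)), by positivity,
    100 * (e + 1), ?_⟩
  intro N hN _ S hS n L _ _ hsum s hs mbar hm hsp hlt M hM₀ hM
  have hND : D ≤ (N : ℝ) := by
    rw [hD]
    exact_mod_cast hN
  have hN0 : (0 : ℝ) < N := hD0.trans_le hND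
  have hR : 1 ≤ (N : ℝ) / D := (one_le_div hD0).2 hND
  set p := mbar + 1 with hp
  obtain ⟨J, hJ⟩ : ∃ J, p = m₀ + J := ⟨p - m₀, by omega⟩
  have hA : 0 < S / N := by positivity
  have hfirst : ∀ m ∈ Ico m₀ p,
      0 < (∑ ℓ ∈ Ico m L, (2 : ℝ) ^ ℓ * (n ℓ : ℝ)) ∧
      s m = (α * (N : ℝ) ^ (e + 1) / (∑ ℓ ∈ Ico m L, (2 : ℝ) ^ ℓ * (n ℓ : ℝ))) ^ q + 2 ^ (m + 2) ∧
      s m < N / D := by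
    intro m hm
    rw [mem_Ico] at hm
    have hsm := hlt m hm.1 (by omega)
    have hsm' := hs m
    split_ifs at hsm' with h0
    · exact absurd hsm' hsm.ne
    refine ⟨?_, ?_, hsm⟩
    · have := Nat.pos_of_ne_zero h0
      exact_mod_cast this
    · rw [hsm'] at hsm ⊢
      exact min_eq_left (((min_lt_iff.1 hsm).resolve_right (lt_irrefl _)).le)
  rw [← hsp]
  have hexp := div_two_pow_le_sum_inv_step hm hM₀ hM (hsp ▸ hR)
  have hpoly := sum_half_pow_mul_le_sum_inv_step hm hM₀ hM fun m hm => by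
    obtain ⟨hT, heq, hlt⟩ := hfirst m hm
    refine ⟨?_, hsp ▸ hlt.le⟩
    rw [heq]
    have h1 : (0 : ℝ) ≤
        (α * (N : ℝ) ^ (e + 1) / (∑ ℓ ∈ Ico m L, (2 : ℝ) ^ ℓ * (n ℓ : ℝ))) ^ q := by positivity
    have h2 : (1 : ℝ) ≤ 2 ^ (m + 2) := one_le_pow₀ (by norm_num)
    linarith
  have hmain := min_mul_log_rpow_le_max hq hq1 ha0 hb0 hA J
  set total := ∑ k ∈ Icc 1 ⌊s p⌋₊, 1 / M k
  have hexp' : N * (a / 2 ^ J) ≤ total := by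
    refine le_trans (le_of_eq ?_) hexp
    rw [hsp, hJ, ha]
    field_simp
    ring
  have hpoly' : N * (b * (1 / (S / N)) ^ q * (J : ℝ) ^ (1 + q)) ≤ total := by
    refine le_trans ?_ hpoly
    have hjensen := card_mul_rpow_le_sum_rpow_inv (t := Ico m₀ p) hq.le
      (by positivity : (0 : ℝ) < 2 * S)
      (fun m hm => mul_pos (by positivity : (0 : ℝ) < 2 ^ (e * m)) (hfirst m hm).1)
      ((sum_two_pow_mul_tail_le he m₀ p L n).trans (by gcongr))
    rw [Nat.card_Ico, hJ, Nat.add_sub_cancel_left, ← hJ] at hjensen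
    have hNe : ((N : ℝ) ^ e) ^ q = N := by
      rw [← Real.rpow_natCast, ← Real.rpow_mul hN0.le, heq, Real.rpow_one]
    calc N * (b * (1 / (S / N)) ^ q * (J : ℝ) ^ (1 + q))
        = 1 / 4 * (α * N ^ (e + 1)) ^ q * (J * (J / (2 * S)) ^ q) := by
          rcases Nat.eq_zero_or_pos J with rfl | hJ0
          · simp [Real.zero_rpow (by linarith : 1 + q ≠ 0)]
          have hJ0' : (0 : ℝ) < J := by exact_mod_cast hJ0
          rw [Real.rpow_add hJ0', Real.rpow_one, hb, pow_succ, one_div_div,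
            Real.mul_rpow hα.le (by positivity), Real.mul_rpow (by positivity) hN0.le, hNe,
            Real.div_rpow hJ0'.le (by positivity), Real.div_rpow hα.le (by positivity),
            Real.div_rpow hN0.le hS.le, Real.mul_rpow (by positivity) hS.le]
          field_simp
      _ ≤ 1 / 4 * (α * N ^ (e + 1)) ^ q * _ :=
          mul_le_mul_of_nonneg_left hjensen (by positivity)
      _ ≤ _ := by
          rw [mul_sum]
          refine sum_le_sum fun m hm => ?_
          obtain ⟨hT, hsm, -⟩ := hfirst m hm
          rw [hsm]
          set T := ∑ ℓ ∈ Ico m L, (2 : ℝ) ^ ℓ * (n ℓ : ℝ)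
          have h2e : ((2 : ℝ) ^ (e * m)) ^ q = 2 ^ m := by
            rw [mul_comm e m, pow_mul, ← Real.rpow_natCast _ e, ← Real.rpow_mul (by positivity),
              heq, Real.rpow_one]
          rw [Real.div_rpow zero_le_one (by positivity), Real.mul_rpow (by positivity) hT.le, h2e,
            Real.one_rpow, Real.div_rpow (by positivity) hT.le, mul_add]
          refine le_add_of_le_of_nonneg (le_of_eq ?_) (by positivity)
          rw [one_div_pow]
          field_simp
          ring
  calc _ = (N : ℝ) * (min (a * (q / (2 * (1 + q))) ^ (1 + q) / 2) (b * (q / 2) ^ (1 + q)) *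
        (1 / (1 + (S / N) ^ q) * Real.log (2 + S / N) ^ (1 + q))) := by ring
    _ ≤ N * max (a / 2 ^ J) (b * (1 / (S / N)) ^ q * (J : ℝ) ^ (1 + q)) := by gcongr
    _ ≤ total := by
      rw [mul_max_of_nonneg _ _ hN0.le]
      exact max_le hexp' hpoly'
end
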